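/- Let p,q ≥ 2 be coprime integers, n ≥ 1 an integer, and let τ be the tau function of Σ(p,q,pqn-1). Then for every integer k with 0 ≤ k ≤ g-2 and every integer i with nk ≤ i < nk + n, one has 2τ(m_{n(g-1)-1-i}) = 2τ(m_{ng+i}) = (k+1)(2i - nk) - 2α_{g+k} + C(n,g), where C(n,g) := g(n - ng + 2) (symmetry of leaf heights). -/

import Mathlib

/-- The numerical semigroup `S_{p,q} = {ap + bq : a,b ∈ ℤ_{≥0}}`, as a set of integers. -/
def Spq (p q : ℤ) : Set ℤ := {s | ∃ a b : ℤ, 0 ≤ a ∧ 0 ≤ b ∧ s = a * p + b * q}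

/-- `Δ_j = 1 - j·e₀ - Σᵢ ⌈j·bᵢ/aᵢ⌉` for the Seifert data
`(e₀, (p,p'), (q,q'), (pqn-1, pqn-n-1))` with `e₀ = -2` of `Σ(p,q,pqn-1)`. -/
noncomputable def brieskornDelta (p q n p' q' : ℤ) (j : ℤ) : ℤ :=
  1 + 2 * j - (⌈(j * p' : ℚ) / (p : ℚ)⌉ + ⌈(j * q' : ℚ) / (q : ℚ)⌉
    + ⌈(j * (p * q * n - n - 1) : ℚ) / (p * q * n - 1 : ℚ)⌉)

/-- The tau function `τ(k) = Σ_{j=0}^{k-1} Δ_j` of `Σ(p,q,pqn-1)`. -/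
noncomputable def brieskornTau (p q n p' q' : ℤ) (k : ℤ) : ℤ :=
  ∑ j ∈ Finset.range k.toNat, brieskornDelta p q n p' q' (j : ℤ)

/-- `α_i = #{s ∈ ℤ_{≥0} : s ∉ S_{p,q}, s > i}`. -/
noncomputable def gapAlpha (p q i : ℤ) : ℕ :=
  Set.ncard {s : ℤ | 0 ≤ s ∧ s ∉ Spq p q ∧ i < s}

/-- The number of pairs `(a, b)` of non-negative integers with `a * p + b * q = u`, as a
quasi-linear function of `u ≥ 0`; here `p'` and `q'` satisfy `q * p' + p * q' = p * q + 1`. -/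
def repCount (p q p' q' u : ℤ) : ℤ := 1 - u + u * p' / p + u * q' / q

/-- The discrete antiderivative of `f : ℤ → ℤ` vanishing at `0`. -/
def antiDiff (f : ℤ → ℤ) (x : ℤ) : ℤ :=
  ∑ u ∈ Finset.range x.toNat, f u - ∑ u ∈ Finset.range (-x).toNat, f (-1 - u)

lemma antiDiff_zero (f : ℤ → ℤ) : antiDiff f 0 = 0 := by simp [antiDiff]

lemma antiDiff_succ (f : ℤ → ℤ) (x : ℤ) : antiDiff f (x + 1) = antiDiff f x + f x := by
  unfold antiDiff
  rcases le_or_gt 0 x with hx | hx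
  · obtain ⟨m, rfl⟩ := Int.eq_ofNat_of_zero_le hx
    have h1 : ((m : ℤ) + 1).toNat = m + 1 := by omega
    have h2 : (-((m : ℤ) + 1)).toNat = 0 := by omega
    have h3 : (-(m : ℤ)).toNat = 0 := by omega
    rw [h1, h2, h3, Finset.sum_range_succ]
    simp
  · obtain ⟨m, hm⟩ := Int.eq_ofNat_of_zero_le (show 0 ≤ -1 - x by omega)
    obtain rfl : x = -1 - m := by omega
    have h1 : (-1 - (m : ℤ) + 1).toNat = 0 := by omega
    have h2 : (-(-1 - (m : ℤ) + 1)).toNat = m := by omega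
    have h3 : (-(-1 - (m : ℤ))).toNat = m + 1 := by omega
    have h4 : (-1 - (m : ℤ)).toNat = 0 := by omega
    rw [h1, h2, h3, h4, Finset.sum_range_succ]
    ring

lemma sum_Ico_eq_antiDiff_sub (f : ℤ → ℤ) {a b : ℤ} (hab : a ≤ b) :
    ∑ u ∈ Finset.Ico a b, f u = antiDiff f b - antiDiff f a := by
  induction b, hab using Int.leInduction with
  | base => simp
  | succ b hab ih =>
    have : Finset.Ico a (b + 1) = insert b (Finset.Ico a b) := by
      ext x; simp only [Finset.mem_Ico, Finset.mem_insert]; omega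
    rw [this, Finset.sum_insert (by simp), ih, antiDiff_succ]
    ring

/-- A function on `ℤ` that is invariant under `x ↦ x + 1` is constant. -/
lemma Int.eq_of_forall_add_one_eq (φ : ℤ → ℤ) (h : ∀ x, φ (x + 1) = φ x) (x y : ℤ) :
    φ x = φ y := by
  have key : ∀ z, φ z = φ 0 := fun z => by
    induction z using Int.induction_on with
    | zero => rfl
    | succ i ih => rw [h, ih]
    | pred i ih => rw [← ih, ← h, sub_add_cancel]
  rw [key x, key y]

/-- The two modular inverses satisfy `q * p' + p * q' = p * q + 1` exactly. -/
lemma mul_inverse_add_mul_inverse {p q p' q' : ℤ} (hp : 2 ≤ p) (hq : 2 ≤ q)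
    (hpq : IsCoprime p q) (hp'0 : 0 < p') (hp'p : p' < p) (hq'0 : 0 < q') (hq'q : q' < q)
    (hp' : q * p' ≡ 1 [ZMOD p]) (hq' : p * q' ≡ 1 [ZMOD q]) :
    q * p' + p * q' = p * q + 1 := by
  have h1 : p ∣ q * p' + p * q' - 1 := by
    have := hp'.symm.dvd
    rw [show q * p' + p * q' - 1 = (q * p' - 1) + p * q' by ring]
    exact dvd_add this (dvd_mul_right _ _)
  have h2 : q ∣ q * p' + p * q' - 1 := by
    have := hq'.symm.dvd
    rw [show q * p' + p * q' - 1 = q * p' + (p * q' - 1) by ring]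
    exact dvd_add (dvd_mul_right _ _) this
  obtain ⟨c, hc⟩ := hpq.mul_dvd h1 h2
  have hpq0 : 0 < p * q := by positivity
  have hlo : 0 < p * q * c := by nlinarith
  have hhi : p * q * c < p * q * 2 := by nlinarith
  have hc0 : 0 < c := pos_of_mul_pos_right hlo hpq0.le
  have hc2 : c < 2 := lt_of_mul_lt_mul_left hhi hpq0.le
  obtain rfl : c = 1 := by omega
  linarith

section RepCount

variable {p q p' q' : ℤ}

lemma eq_remainders_add_repCount (h : q * p' + p * q' = p * q + 1) (u : ℤ) :
    u = q * (u * p' % p) + p * (u * q' % q) + p * q * (repCount p q p' q' u - 1) := by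
  have h1 := Int.mul_ediv_add_emod (u * p') p
  have h2 := Int.mul_ediv_add_emod (u * q') q
  unfold repCount
  linear_combination (-q) * h1 - p * h2 - u * h

lemma repCount_zero : repCount p q p' q' 0 = 1 := by simp [repCount]

lemma repCount_add_mul (hp : 2 ≤ p) (hq : 2 ≤ q) (h : q * p' + p * q' = p * q + 1) (u : ℤ) :
    repCount p q p' q' (u + p * q) = repCount p q p' q' u + 1 := by
  unfold repCount
  rw [show (u + p * q) * p' = u * p' + p * (q * p') by ring,
    show (u + p * q) * q' = u * q' + q * (p * q') by ring,
    Int.add_mul_ediv_left _ _ (by omega), Int.add_mul_ediv_left _ _ (by omega)]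
  linear_combination h

lemma Int.neg_one_sub_ediv {a b : ℤ} (hb : 0 < b) : (-1 - a) / b = -1 - a / b := by
  have h1 := Int.mul_ediv_add_emod a b
  have h2 := Int.emod_nonneg a hb.ne'
  have h3 := Int.emod_lt_of_pos a hb
  rw [Int.ediv_eq_iff_of_pos hb]
  constructor <;> nlinarith

lemma repCount_reflect (hp : 2 ≤ p) (hq : 2 ≤ q) (h : q * p' + p * q' = p * q + 1) (u : ℤ) :
    repCount p q p' q' (p * q - p - q - u) = 1 - repCount p q p' q' u := by
  unfold repCount
  rw [show (p * q - p - q - u) * p' = (-1 - u * p') + p * (q * p' - p' - q + q') by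
      linear_combination -h,
    show (p * q - p - q - u) * q' = (-1 - u * q') + q * (p * q' - q' - p + p') by
      linear_combination -h,
    Int.add_mul_ediv_left _ _ (by omega), Int.add_mul_ediv_left _ _ (by omega),
    Int.neg_one_sub_ediv (by omega), Int.neg_one_sub_ediv (by omega)]
  linear_combination h

lemma repCount_pos_iff_mem (hp : 2 ≤ p) (hq : 2 ≤ q) (h : q * p' + p * q' = p * q + 1) (u : ℤ) :
    1 ≤ repCount p q p' q' u ↔ u ∈ Spq p q := by
  constructor
  · intro hu
    refine ⟨u * q' % q + q * (repCount p q p' q' u - 1), u * p' % p, ?_,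
      Int.emod_nonneg _ (by omega), ?_⟩
    · have := Int.emod_nonneg (u * q') (show q ≠ 0 by omega)
      have : 0 ≤ q * (repCount p q p' q' u - 1) := mul_nonneg (by omega) (by omega)
      omega
    · linear_combination eq_remainders_add_repCount h u
  · rintro ⟨a, b, ha, hb, rfl⟩
    unfold repCount
    rw [show (a * p + b * q) * p' = b + p * (a * p' + b * q - b * q') by linear_combination b * h,
      show (a * p + b * q) * q' = a + q * (a * p - a * p' + b * q') by linear_combination a * h,
      Int.add_mul_ediv_left _ _ (by omega), Int.add_mul_ediv_left _ _ (by omega)]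
    have := Int.ediv_nonneg hb (show 0 ≤ p by omega)
    have := Int.ediv_nonneg ha (show 0 ≤ q by omega)
    linarith

lemma repCount_nonneg (hp : 2 ≤ p) (hq : 2 ≤ q) (h : q * p' + p * q' = p * q + 1) {u : ℤ}
    (hu : 0 ≤ u) : 0 ≤ repCount p q p' q' u := by
  have h1 := Int.emod_lt_of_pos (u * p') (show 0 < p by omega)
  have h2 := Int.emod_lt_of_pos (u * q') (show 0 < q by omega)
  have h3 := eq_remainders_add_repCount h u
  by_contra! hneg
  have : p * q * (repCount p q p' q' u - 1) ≤ p * q * (-2) :=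
    mul_le_mul_of_nonneg_left (by omega) (by positivity)
  nlinarith

lemma repCount_pos_of_conductor_le (hp : 2 ≤ p) (hq : 2 ≤ q)
    (h : q * p' + p * q' = p * q + 1) {u : ℤ} (hu : (p - 1) * (q - 1) ≤ u) :
    1 ≤ repCount p q p' q' u := by
  have h1 := Int.emod_lt_of_pos (u * p') (show 0 < p by omega)
  have h2 := Int.emod_lt_of_pos (u * q') (show 0 < q by omega)
  have h3 := eq_remainders_add_repCount h u
  by_contra! hneg
  have : p * q * (repCount p q p' q' u - 1) ≤ p * q * (-1) :=
    mul_le_mul_of_nonneg_left (by omega) (by positivity)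
  nlinarith

lemma repCount_le_one (hp : 2 ≤ p) (hq : 2 ≤ q) (h : q * p' + p * q' = p * q + 1) {u : ℤ}
    (hu : u < p * q) : repCount p q p' q' u ≤ 1 := by
  have h1 := Int.emod_nonneg (u * p') (show p ≠ 0 by omega)
  have h2 := Int.emod_nonneg (u * q') (show q ≠ 0 by omega)
  have h3 := eq_remainders_add_repCount h u
  by_contra! hneg
  have : p * q * 1 ≤ p * q * (repCount p q p' q' u - 1) :=
    mul_le_mul_of_nonneg_left (by omega) (by positivity)
  nlinarith

/-- Symmetry of the counting function of the semigroup. -/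
lemma antiDiff_repCount_reflect (hp : 2 ≤ p) (hq : 2 ≤ q) (h : q * p' + p * q' = p * q + 1)
    {g : ℤ} (hg : 2 * g = (p - 1) * (q - 1)) (x : ℤ) :
    antiDiff (repCount p q p' q') (2 * g - x) = antiDiff (repCount p q p' q') x - x + g := by
  have hstep : ∀ y, antiDiff (repCount p q p' q') (2 * g - (y + 1))
        - antiDiff (repCount p q p' q') (y + 1) + (y + 1)
      = antiDiff (repCount p q p' q') (2 * g - y) - antiDiff (repCount p q p' q') y + y := by
    intro y
    have h1 := antiDiff_succ (repCount p q p' q') y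
    have h2 := antiDiff_succ (repCount p q p' q') (2 * g - (y + 1))
    have h3 := repCount_reflect hp hq h y
    rw [show p * q - p - q - y = 2 * g - (y + 1) by linear_combination -hg] at h3
    rw [show 2 * g - (y + 1) + 1 = 2 * g - y by ring] at h2
    linarith
  have := Int.eq_of_forall_add_one_eq
    (fun y => antiDiff (repCount p q p' q') (2 * g - y) - antiDiff (repCount p q p' q') y + y) hstep x g
  beta_reduce at this
  rw [show 2 * g - g = g by ring] at this
  linarith

lemma antiDiff_repCount_add_mul (hp : 2 ≤ p) (hq : 2 ≤ q) (h : q * p' + p * q' = p * q + 1)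
    {g : ℤ} (hg : 2 * g = (p - 1) * (q - 1)) (x : ℤ) :
    antiDiff (repCount p q p' q') (x + p * q)
      = antiDiff (repCount p q p' q') x + x + (p * q - g) := by
  have hstep : ∀ y, antiDiff (repCount p q p' q') (y + 1 + p * q)
        - antiDiff (repCount p q p' q') (y + 1) - (y + 1)
      = antiDiff (repCount p q p' q') (y + p * q) - antiDiff (repCount p q p' q') y - y := by
    intro y
    have h1 := antiDiff_succ (repCount p q p' q') y
    have h2 := antiDiff_succ (repCount p q p' q') (y + p * q)
    have h3 := repCount_add_mul hp hq h y
    rw [show y + p * q + 1 = y + 1 + p * q by ring] at h2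
    linarith
  have hconst := Int.eq_of_forall_add_one_eq
    (fun y => antiDiff (repCount p q p' q') (y + p * q) - antiDiff (repCount p q p' q') y - y) hstep
  have hx := hconst x 0
  have hy := hconst (2 * g - p * q) 0
  have h1 := antiDiff_repCount_reflect hp hq h hg (p * q)
  have h2 := antiDiff_repCount_reflect hp hq h hg 0
  have h0 := antiDiff_zero (repCount p q p' q')
  simp only [sub_add_cancel, zero_add, sub_zero] at hx hy h2
  linarith

lemma antiDiff_repCount_sub_mul (hp : 2 ≤ p) (hq : 2 ≤ q) (h : q * p' + p * q' = p * q + 1)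
    {g : ℤ} (hg : 2 * g = (p - 1) * (q - 1)) (x : ℤ) (I : ℕ) :
    2 * antiDiff (repCount p q p' q') (x - p * q * I)
      = 2 * antiDiff (repCount p q p' q') x - 2 * I * (x + p * q - g) + p * q * I * (I + 1) := by
  induction I with
  | zero => simp
  | succ I ih =>
    have h1 := antiDiff_repCount_add_mul hp hq h hg (x - p * q * (I + 1))
    rw [show x - p * q * ((I : ℤ) + 1) + p * q = x - p * q * I by ring] at h1
    push_cast
    linear_combination ih - 2 * h1

lemma gapAlpha_eq (hp : 2 ≤ p) (hq : 2 ≤ q) (h : q * p' + p * q' = p * q + 1)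
    {g : ℤ} (hg : 2 * g = (p - 1) * (q - 1)) {l : ℤ} (hl0 : -1 ≤ l) (hl : l < 2 * g) :
    (gapAlpha p q l : ℤ) = antiDiff (repCount p q p' q') (l + 1) + g - 1 - l := by
  classical
  have hset : {s : ℤ | 0 ≤ s ∧ s ∉ Spq p q ∧ l < s}
      = ((Finset.Ico (l + 1) (2 * g)).filter (fun s => s ∉ Spq p q) : Finset ℤ) := by
    ext s
    simp only [Set.mem_ofPred_eq, Finset.coe_filter, Finset.mem_Ico]
    constructor
    · rintro ⟨-, hs, hls⟩
      refine ⟨⟨by omega, ?_⟩, hs⟩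
      by_contra! hge
      exact hs ((repCount_pos_iff_mem hp hq h s).1
        (repCount_pos_of_conductor_le hp hq h (hg ▸ hge)))
    · rintro ⟨⟨hls, -⟩, hs⟩
      exact ⟨by omega, hs, by omega⟩
  have hsum : ∑ u ∈ Finset.Ico (l + 1) (2 * g), (if u ∉ Spq p q then (1 : ℤ) else 0)
      = ∑ u ∈ Finset.Ico (l + 1) (2 * g), (1 - repCount p q p' q' u) := by
    refine Finset.sum_congr rfl fun u hu => ?_
    rw [Finset.mem_Ico] at hu
    have h0 := repCount_nonneg hp hq h (show 0 ≤ u by omega)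
    have h1 := repCount_le_one hp hq h (show u < p * q by nlinarith)
    have h2 := repCount_pos_iff_mem hp hq h u
    split_ifs with hs
    · have := h2.2 hs
      omega
    · have := mt h2.1 hs
      omega
  have hrefl := antiDiff_repCount_reflect hp hq h hg 0
  rw [antiDiff_zero, sub_zero] at hrefl
  rw [gapAlpha, hset, Set.ncard_coe_finset, Finset.card_filter]
  push_cast
  rw [hsum, Finset.sum_sub_distrib, sum_Ico_eq_antiDiff_sub (repCount p q p' q') (by omega),
    hrefl,
    Finset.sum_const, Int.card_Ico, nsmul_eq_mul, Int.toNat_of_nonneg (by omega)]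
  ring

end RepCount

lemma ceil_intCast_div_intCast (a : ℤ) {b : ℤ} (hb : 0 < b) :
    ⌈(a : ℚ) / (b : ℚ)⌉ = -(-a / b) := by
  have hb' : (0 : ℚ) < b := by exact_mod_cast hb
  have h1 := Int.mul_ediv_add_emod (-a) b
  have h2 := Int.emod_nonneg (-a) hb.ne'
  have h3 := Int.emod_lt_of_pos (-a) hb
  rw [Int.ceil_eq_iff, lt_div_iff₀ hb', div_le_iff₀ hb']
  constructor
  · exact_mod_cast (show (-(-a / b) - 1) * b < a by nlinarith)
  · exact_mod_cast (show a ≤ -(-a / b) * b by nlinarith)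

lemma brieskornDelta_eq {p q n : ℤ} (p' q' : ℤ) (hp : 2 ≤ p) (hq : 2 ≤ q) (hn : 1 ≤ n) (j : ℤ) :
    brieskornDelta p q n p' q' j
      = repCount p q p' q' (-j) + j * n / (p * q * n - 1) := by
  have hr : 0 < p * q * n - 1 := by nlinarith [mul_le_mul hp hq (by norm_num) (by omega)]
  have h1 := ceil_intCast_div_intCast (j * p') (show 0 < p by omega)
  have h2 := ceil_intCast_div_intCast (j * q') (show 0 < q by omega)
  have h3 := ceil_intCast_div_intCast (j * (p * q * n - n - 1)) hr
  rw [show -(j * (p * q * n - n - 1)) = j * n + (p * q * n - 1) * (-j) by ring,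
    Int.add_mul_ediv_left _ _ hr.ne'] at h3
  push_cast at h1 h2 h3
  rw [brieskornDelta, h1, h2, h3, repCount, neg_mul, neg_mul]
  ring

/-- `τ` increases by a difference of values of `antiDiff` plus a linear term on an interval where
`⌊j * n / (p * q * n - 1)⌋` is constant. -/
lemma brieskornTau_sub {p q n : ℤ} (p' q' : ℤ) (hp : 2 ≤ p) (hq : 2 ≤ q) (hn : 1 ≤ n)
    {a b I : ℤ} (ha : 0 ≤ a) (hab : a ≤ b)
    (hI : ∀ j, a ≤ j → j < b → j * n / (p * q * n - 1) = I) :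
    brieskornTau p q n p' q' b = brieskornTau p q n p' q' a
      + antiDiff (repCount p q p' q') (1 - a) - antiDiff (repCount p q p' q') (1 - b)
      + I * (b - a) := by
  induction b, hab using Int.leInduction with
  | base => ring
  | succ b hab ih =>
    have ih := ih fun j h1 h2 => hI j h1 (by omega)
    have h1 : brieskornTau p q n p' q' (b + 1)
        = brieskornTau p q n p' q' b + brieskornDelta p q n p' q' b := by
      unfold brieskornTau
      rw [show (b + 1).toNat = b.toNat + 1 by omega, Finset.sum_range_succ,
        Int.toNat_of_nonneg (by omega)]
    have h2 := antiDiff_succ (repCount p q p' q') (-b)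
    rw [show -b + 1 = 1 - b by ring] at h2
    rw [h1, ih, brieskornDelta_eq p' q' hp hq hn, hI b hab (by omega), h2,
      show 1 - (b + 1) = -b by ring]
    ring

lemma mul_ediv_eq_of_mem {P n I j : ℤ} (hP : 2 ≤ P) (hn : 1 ≤ n)
    (h1 : P * I - I / n ≤ j) (h2 : j < P * (I + 1) - (I + 1) / n) :
    j * n / (P * n - 1) = I := by
  have hr : 0 < P * n - 1 := by nlinarith
  rw [Int.ediv_eq_iff_of_pos hr]
  have e1 := Int.mul_ediv_add_emod I n
  have e2 := Int.emod_nonneg I (show n ≠ 0 by omega)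
  have e3 := Int.mul_ediv_add_emod (I + 1) n
  have e4 := Int.emod_lt_of_pos (I + 1) (show 0 < n by omega)
  constructor
  · nlinarith [mul_le_mul_of_nonneg_right h1 (show 0 ≤ n by omega)]
  · have h2' : j + 1 ≤ P * (I + 1) - (I + 1) / n := h2
    nlinarith [mul_le_mul_of_nonneg_right h2' (show 0 ≤ n by omega)]

/-- `⌊(I + 1) / n⌋` either stays or jumps by one, the latter at multiples of `n`. -/
lemma add_one_ediv_cases {n : ℤ} (hn : 1 ≤ n) (I : ℤ) :
    (I + 1) / n = I / n ∨ ((I + 1) / n = I / n + 1 ∧ I + 1 = n * (I / n + 1)) := by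
  have e1 := Int.mul_ediv_add_emod I n
  have e2 := Int.emod_nonneg I (show n ≠ 0 by omega)
  have e3 := Int.emod_lt_of_pos I (show 0 < n by omega)
  rcases eq_or_ne (I % n + 1) n with h | h
  · right
    have : I + 1 = n * (I / n + 1) := by linarith
    refine ⟨?_, this⟩
    conv_lhs => rw [this]
    exact Int.mul_ediv_cancel_left _ (by omega)
  · left
    rw [Int.ediv_eq_iff_of_pos (by omega)]
    have : I % n + 1 < n := by omega
    constructor <;> nlinarith

lemma brieskornTau_leaf_eq_antiDiff {p q n : ℤ} (p' q' : ℤ) (hp : 2 ≤ p) (hq : 2 ≤ q)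
    (hn : 1 ≤ n) (I : ℕ) :
    2 * brieskornTau p q n p' q' (p * q * I - I / n)
      = 2 - 2 * antiDiff (repCount p q p' q') (1 - (p * q * I - I / n))
        + p * q * I * (I - 1) - n * (I / n) * (I / n + 1) + 2 * (I / n) := by
  have hP : 2 ≤ p * q := by nlinarith
  induction I with
  | zero =>
    have h1 := antiDiff_succ (repCount p q p' q') 0
    rw [antiDiff_zero, repCount_zero] at h1
    simp only [zero_add] at h1
    simp [brieskornTau, h1]
  | succ I ih =>
    have hI : (0 : ℤ) ≤ I := by positivity
    have hlI : (I : ℤ) / n ≤ I := Int.ediv_le_self _ hI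
    have ha : 0 ≤ p * q * I - I / n := by nlinarith
    have hc := add_one_ediv_cases hn (I : ℤ)
    have hab : p * q * I - I / n ≤ p * q * ((I : ℤ) + 1) - ((I : ℤ) + 1) / n := by
      rcases hc with h | ⟨h, -⟩ <;> rw [h] <;> nlinarith
    have hstep := brieskornTau_sub p' q' hp hq hn ha hab
      fun j h1 h2 => mul_ediv_eq_of_mem hP hn h1 h2
    push_cast
    rcases hc with h | ⟨h, hmul⟩
    · rw [h] at hstep ⊢
      linear_combination 2 * hstep + ih
    · rw [h] at hstep ⊢
      linear_combination 2 * hstep + ih - 2 * hmul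

/-- The leaf heights `τ(m_I)` of the graded root, in terms of the gap counts of the semigroup. -/
lemma brieskornTau_leaf {p q n p' q' : ℤ} (hp : 2 ≤ p) (hq : 2 ≤ q) (hn : 1 ≤ n)
    (h : q * p' + p * q' = p * q + 1) {g : ℤ} (hg : 2 * g = (p - 1) * (q - 1))
    {I l : ℤ} (hI : 0 ≤ I) (hIl : I / n = l) :
    2 * brieskornTau p q n p' q' (p * q * I - I / n)
      = 2 * I * (1 - g + l) + 2 * (l + 1) - 2 * antiDiff (repCount p q p' q') (l + 1)
        - n * l * (l + 1) := by
  obtain ⟨m, rfl⟩ := Int.eq_ofNat_of_zero_le hI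
  have h1 := brieskornTau_leaf_eq_antiDiff p' q' hp hq hn m
  have h2 := antiDiff_repCount_sub_mul hp hq h hg (l + 1) m
  rw [hIl] at h1 ⊢
  rw [show 1 - (p * q * (m : ℤ) - l) = l + 1 - p * q * m by ring] at h1
  linear_combination h1 - h2

/-- Symmetry of leaf heights for the graded root of `Σ(p,q,pqn-1)` (coprime `p,q ≥ 2`,
`n ≥ 1`), with `g = (p-1)(q-1)/2`, `m_i = pqi - ⌊i/n⌋` and `α_i = #{s ∉ S_{p,q} : s > i}`:
for `0 ≤ k ≤ g-2` and `nk ≤ i < nk + n`,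
`2τ(m_{n(g-1)-1-i}) = 2τ(m_{ng+i}) = (k+1)(2i - nk) - 2α_{g+k} + C(n,g)`,
where `C(n,g) = g(n - ng + 2)`. -/
theorem brieskornTau_leaf_symmetry (p q n p' q' : ℤ) (hp : 2 ≤ p) (hq : 2 ≤ q)
    (hpq : IsCoprime p q) (hn : 1 ≤ n)
    (hp'0 : 0 < p') (hp'p : p' < p) (hq'0 : 0 < q') (hq'q : q' < q)
    (hp' : q * p' ≡ 1 [ZMOD p]) (hq' : p * q' ≡ 1 [ZMOD q])
    (g : ℤ) (hg : 2 * g = (p - 1) * (q - 1))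
    (k : ℤ) (hk0 : 0 ≤ k) (hkg : k ≤ g - 2)
    (i : ℤ) (hi1 : n * k ≤ i) (hi2 : i < n * k + n) :
    2 * brieskornTau p q n p' q'
        (p * q * (n * (g - 1) - 1 - i) - (n * (g - 1) - 1 - i) / n)
      = (k + 1) * (2 * i - n * k) - 2 * (gapAlpha p q (g + k) : ℤ) + g * (n - n * g + 2) ∧
    2 * brieskornTau p q n p' q' (p * q * (n * g + i) - (n * g + i) / n)
      = (k + 1) * (2 * i - n * k) - 2 * (gapAlpha p q (g + k) : ℤ) + g * (n - n * g + 2) := by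
  have h := mul_inverse_add_mul_inverse hp hq hpq hp'0 hp'p hq'0 hq'q hp' hq'
  have hα := gapAlpha_eq hp hq h hg (l := g + k) (by omega) (by omega)
  have hn0 : 0 < n := by omega
  have hl : (n * (g - 1) - 1 - i) / n = g - k - 2 := by
    rw [Int.ediv_eq_iff_of_pos hn0]
    constructor <;> nlinarith
  have hl' : (n * g + i) / n = g + k := by
    rw [Int.ediv_eq_iff_of_pos hn0]
    constructor <;> nlinarith
  have hI : 0 ≤ n * (g - 1) - 1 - i := by nlinarith
  have hI' : 0 ≤ n * g + i := by nlinarith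
  constructor
  · have hs := antiDiff_repCount_reflect hp hq h hg (g + k + 1)
    rw [show 2 * g - (g + k + 1) = g - k - 2 + 1 by ring] at hs
    rw [brieskornTau_leaf hp hq hn h hg hI hl, hα, hs]
    ring
  · rw [brieskornTau_leaf hp hq hn h hg hI' hl', hα]
    ring
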